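/- arXiv:1512.04297 — 2 statements merged into one kernel-verified Lean document; each statement's English description precedes it below -/
import Mathlib

section
/- For every integer m ≥ 2: (a) the maximum cardinality of a partial 3-spread in 𝔽_2^{3m} equals (2^{3m} − 1)/7; (b) the maximum cardinality of a partial 3-spread in 𝔽_2^{3m+1} equals (2^{3m+1} − 9)/7; (c) the maximum cardinality of a partial 3-spread in 𝔽_2^{3m+2} equals (2^{3m+2} − 18)/7. -/
/-- A partial `k`-spread in `𝔽_2^n`: a set of `k`-dimensional subspaces
any two distinct members of which intersect trivially. -/
def IsPartialSpread {n : ℕ} (k : ℕ)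
    (S : Finset (Submodule (ZMod 2) (Fin n → ZMod 2))) : Prop :=
  (∀ U ∈ S, Module.finrank (ZMod 2) U = k) ∧
  ∀ U ∈ S, ∀ V ∈ S, U ≠ V → U ⊓ V = ⊥

open Finset

def Spr.ind (a : ZMod 2) : ℤ := if a = 0 then 0 else 1

theorem Spr.ind_add_one : ∀ a : ZMod 2, Spr.ind (a + 1) = 1 - Spr.ind a := by decide

theorem Spr.ind_mul : ∀ a b : ZMod 2,
    2 * (Spr.ind a * Spr.ind b) = Spr.ind a + Spr.ind b - Spr.ind (a + b) := by decide

theorem Spr.ind_sq : ∀ a : ZMod 2, Spr.ind a * Spr.ind a = Spr.ind a := by decide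

theorem Spr.sum_ind {W : Type*} [AddCommGroup W] [Fintype W] (f : W →+ ZMod 2) (hf : f ≠ 0) :
    2 * ∑ x, Spr.ind (f x) = (Fintype.card W : ℤ) := by
  have h1 : ∃ e, f e = 1 := by
    by_contra! h
    apply hf
    ext x
    have : ∀ a : ZMod 2, a ≠ 1 → a = 0 := by decide
    exact this _ (h x)
  obtain ⟨e, he⟩ := h1
  have h2 : ∑ x, Spr.ind (f x) = ∑ x, (1 - Spr.ind (f x)) := by
    rw [← Equiv.sum_comp (Equiv.addRight e) (fun x => Spr.ind (f x))]
    apply Finset.sum_congr rfl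
    intro x _
    simp [he, Spr.ind_add_one]
  rw [Finset.sum_sub_distrib] at h2
  simp at h2
  linarith

/-- the functional `x ↦ f ⬝ᵥ x`. -/
def Spr.dot {n : ℕ} (f : Fin n → ZMod 2) : (Fin n → ZMod 2) →+ ZMod 2 where
  toFun x := f ⬝ᵥ x
  map_zero' := by simp
  map_add' x y := by simp

theorem Spr.dot_ne {n : ℕ} (f : Fin n → ZMod 2) (hf : f ≠ 0) : Spr.dot f ≠ 0 := by
  intro h
  apply hf
  funext i
  have := DFunLike.congr_fun h (Pi.single i 1)
  simpa [Spr.dot] using this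

theorem Spr.dot_comm {n : ℕ} (f x : Fin n → ZMod 2) : Spr.dot f x = Spr.dot x f := by
  simp [Spr.dot, dotProduct_comm]

theorem Spr.sum_one {n : ℕ} (x : Fin n → ZMod 2) (hx : x ≠ 0) :
    2 * ∑ f, Spr.ind (Spr.dot f x) = (2 : ℤ) ^ n := by
  have := Spr.sum_ind (Spr.dot x) (Spr.dot_ne x hx)
  simp only [Spr.dot_comm _ x]
  rw [this]; simp [ZMod.card]

theorem Spr.sum_two {n : ℕ} (x y : Fin n → ZMod 2) (hx : x ≠ 0) (hy : y ≠ 0) (hxy : x ≠ y) :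
    4 * ∑ f, Spr.ind (Spr.dot f x) * Spr.ind (Spr.dot f y) = (2 : ℤ) ^ n := by
  have hs : x + y ≠ 0 := by
    intro h
    apply hxy
    funext i
    have h2 : ∀ a b : ZMod 2, a + b = 0 → a = b := by decide
    exact h2 _ _ (congrFun h i)
  have h1 := Spr.sum_one x hx
  have h2 := Spr.sum_one y hy
  have h3 := Spr.sum_one _ hs
  have h4 : 2 * ∑ f, Spr.ind (Spr.dot f x) * Spr.ind (Spr.dot f y) =
      ∑ f, Spr.ind (Spr.dot f x) + ∑ f, Spr.ind (Spr.dot f y)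
        - ∑ f, Spr.ind (Spr.dot f (x + y)) := by
    rw [Finset.mul_sum, ← Finset.sum_add_distrib, ← Finset.sum_sub_distrib]
    apply Finset.sum_congr rfl
    intro f _
    rw [Spr.ind_mul, map_add]
  linarith

/-- First two moments of weights. -/
theorem Spr.moments {n : ℕ} (H : Finset (Fin n → ZMod 2)) (h0 : ∀ x ∈ H, x ≠ 0) :
    2 * ∑ f, ∑ x ∈ H, Spr.ind (Spr.dot f x) = (#H : ℤ) * 2 ^ n ∧
    4 * ∑ f, (∑ x ∈ H, Spr.ind (Spr.dot f x)) ^ 2 = ((#H : ℤ) ^ 2 + #H) * 2 ^ n := by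
  constructor
  · rw [Finset.sum_comm, Finset.mul_sum, Finset.sum_congr rfl (fun x hx => Spr.sum_one x (h0 x hx))]
    simp
  · have h1 : ∑ f, (∑ x ∈ H, Spr.ind (Spr.dot f x)) ^ 2 =
        ∑ x ∈ H, ∑ y ∈ H, ∑ f, Spr.ind (Spr.dot f x) * Spr.ind (Spr.dot f y) := by
      simp only [sq, Finset.sum_mul_sum]
      rw [Finset.sum_comm]
      apply Finset.sum_congr rfl
      intro x _
      rw [Finset.sum_comm]
    rw [h1, Finset.mul_sum]
    have h2 : ∀ x ∈ H, 4 * ∑ y ∈ H, ∑ f, Spr.ind (Spr.dot f x) * Spr.ind (Spr.dot f y)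
        = ((#H : ℤ) + 1) * 2 ^ n := by
      intro x hx
      rw [Finset.mul_sum]
      have h3 : ∀ y ∈ H, 4 * ∑ f, Spr.ind (Spr.dot f x) * Spr.ind (Spr.dot f y)
          = 2 ^ n + if x = y then 2 ^ n else 0 := by
        intro y hy
        split_ifs with hxy
        · subst hxy
          simp only [Spr.ind_sq]
          have := Spr.sum_one x (h0 x hx)
          linarith
        · rw [Spr.sum_two x y (h0 x hx) (h0 y hy) hxy]; simp
      rw [Finset.sum_congr rfl h3, Finset.sum_add_distrib]
      simp [hx]
      ring
    rw [Finset.sum_congr rfl h2]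
    simp
    ring

open Classical in
/-- holes of a partial spread -/
noncomputable def Spr.holes {n : ℕ} (S : Finset (Submodule (ZMod 2) (Fin n → ZMod 2))) :
    Finset (Fin n → ZMod 2) := Finset.univ.filter (fun x => x ≠ 0 ∧ ∀ U ∈ S, x ∉ U)

open Classical in
theorem Spr.decomp {n : ℕ} (S : Finset (Submodule (ZMod 2) (Fin n → ZMod 2)))
    (hS : IsPartialSpread 3 S) (g : (Fin n → ZMod 2) → ℤ) (g0 : g 0 = 0) :
    ∑ x, g x = ∑ x ∈ Spr.holes S, g x + ∑ U ∈ S, ∑ x : U, g x := by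
  have h1 : ∀ U : Submodule (ZMod 2) (Fin n → ZMod 2),
      ∑ x : U, g x = ∑ x, if x ∈ U then g x else 0 := by
    intro U
    rw [← Finset.sum_filter]
    symm
    apply Finset.sum_subtype
    simp
  simp only [h1]
  rw [Finset.sum_comm, Spr.holes, Finset.sum_filter, ← Finset.sum_add_distrib]
  apply Finset.sum_congr rfl
  intro x _
  by_cases hx : x = 0
  · subst hx; simp [g0]
  by_cases hU : ∃ U ∈ S, x ∈ U
  · obtain ⟨U, hU, hxU⟩ := hU
    rw [if_neg (by push Not; intro _; exact ⟨U, hU, hxU⟩), zero_add,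
      Finset.sum_eq_single_of_mem U hU, if_pos hxU]
    intro V hV hVU
    rw [if_neg]
    intro hxV
    have : x ∈ V ⊓ U := ⟨hxV, hxU⟩
    rw [hS.2 V hV U hU hVU] at this
    exact hx (by simpa using this)
  · push Not at hU
    rw [if_pos ⟨hx, hU⟩, Finset.sum_eq_zero, add_zero]
    intro U hUS
    rw [if_neg (hU U hUS)]

theorem Spr.card_sub {n : ℕ} (U : Submodule (ZMod 2) (Fin n → ZMod 2)) [Fintype U]
    (h : Module.finrank (ZMod 2) U = 3) : Fintype.card U = 8 := by
  rw [Module.card_eq_pow_finrank (K := ZMod 2), h]; simp [ZMod.card]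

open Classical in
theorem Spr.card_holes {n : ℕ} (S : Finset (Submodule (ZMod 2) (Fin n → ZMod 2)))
    (hS : IsPartialSpread 3 S) : #(Spr.holes S) + 7 * #S + 1 = 2 ^ n := by
  have h := Spr.decomp S hS (fun x => if x = 0 then 0 else 1) (by simp)
  have key : ∀ (s : Finset (Fin n → ZMod 2)), (∀ x ∈ s, x ≠ 0) →
      ∑ x ∈ s, (if x = 0 then (0:ℤ) else 1) = #s := by
    intro s hs
    rw [Finset.sum_congr rfl (fun x hx => if_neg (hs x hx))]; simp
  rw [key (Spr.holes S) (by intro x hx; simp [Spr.holes] at hx; exact hx.1)] at h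
  have h2 : ∀ U ∈ S, ∑ x : U, (if (x : Fin n → ZMod 2) = 0 then (0:ℤ) else 1) = 7 := by
    intro U hU
    have h3 : ∀ x : U, (if (x : Fin n → ZMod 2) = 0 then (0:ℤ) else 1)
        = 1 - if x = 0 then 1 else 0 := by
      intro x; by_cases hx : x = 0 <;> simp [hx]
    simp only [h3, Finset.sum_sub_distrib]
    simp [Spr.card_sub U (hS.1 U hU)]
  rw [Finset.sum_congr rfl h2] at h
  have h3 : ∀ x : (Fin n → ZMod 2), (if x = 0 then (0:ℤ) else 1)
        = 1 - if x = 0 then 1 else 0 := by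
      intro x; by_cases hx : x = 0 <;> simp [hx]
  simp only [h3, Finset.sum_sub_distrib] at h
  simp [ZMod.card] at h
  zify
  linarith

open Classical in
theorem Spr.div_four {n : ℕ} (hn : 3 ≤ n) (S : Finset (Submodule (ZMod 2) (Fin n → ZMod 2)))
    (hS : IsPartialSpread 3 S) (f : Fin n → ZMod 2) :
    (4 : ℤ) ∣ ∑ x ∈ Spr.holes S, Spr.ind (Spr.dot f x) := by
  have h := Spr.decomp S hS (fun x => Spr.ind (Spr.dot f x)) (by simp [Spr.ind])
  have h1 : (4 : ℤ) ∣ ∑ x, Spr.ind (Spr.dot f x) := by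
    by_cases hf : Spr.dot f = 0
    · simp [hf, Spr.ind]
    · have := Spr.sum_ind _ hf
      obtain ⟨k, rfl⟩ := Nat.exists_eq_add_of_le hn
      simp [ZMod.card, pow_add] at this
      exact ⟨2 ^ k, by linarith⟩
  have h2 : (4 : ℤ) ∣ ∑ U ∈ S, ∑ x : U, Spr.ind (Spr.dot f x) := by
    apply Finset.dvd_sum
    intro U hU
    by_cases hf : (Spr.dot f).comp U.subtype.toAddMonoidHom = 0
    · have : ∀ x : U, Spr.dot f x = 0 := fun x => DFunLike.congr_fun hf x
      simp [this, Spr.ind]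
    · have := Spr.sum_ind _ hf
      rw [Spr.card_sub U (hS.1 U hU)] at this
      simp at this
      exact ⟨1, by linarith⟩
  have h3 : ∑ x ∈ Spr.holes S, Spr.ind (Spr.dot f x) =
    ∑ x, Spr.ind (Spr.dot f x) - ∑ U ∈ S, ∑ x : U, Spr.ind (Spr.dot f x) := by linarith
  rw [h3]
  exact dvd_sub h1 h2

theorem Spr.ineq {n : ℕ} (hn : 3 ≤ n) (S : Finset (Submodule (ZMod 2) (Fin n → ZMod 2)))
    (hS : IsPartialSpread 3 S) (b : ℤ) :
    0 ≤ ((#(Spr.holes S) : ℤ) ^ 2 + #(Spr.holes S)) - 2 * (8 * b + 4) * #(Spr.holes S)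
      + 64 * b * (b + 1) := by
  obtain ⟨m1, m2⟩ := Spr.moments (Spr.holes S)
    (by intro x hx; simp [Spr.holes] at hx; exact hx.1)
  have h : 0 ≤ ∑ f : Fin n → ZMod 2, ((∑ x ∈ Spr.holes S, Spr.ind (Spr.dot f x)) ^ 2
      - (8 * b + 4) * (∑ x ∈ Spr.holes S, Spr.ind (Spr.dot f x)) + 16 * b * (b + 1)) := by
    apply Finset.sum_nonneg
    intro f _
    obtain ⟨k, hk⟩ := Spr.div_four hn S hS f
    rw [hk]
    rcases le_or_gt k b with h | h
    · nlinarith [mul_nonneg (sub_nonneg.2 h) (by linarith : 0 ≤ b + 1 - k)]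
    · have : b + 1 ≤ k := h
      nlinarith [mul_nonneg (sub_nonneg.2 this) (by linarith : 0 ≤ k - b)]
  rw [Finset.sum_add_distrib, Finset.sum_sub_distrib, ← Finset.mul_sum] at h
  simp [ZMod.card] at h
  have hN : (0 : ℤ) < 2 ^ n := by positivity
  have : 0 ≤ (((#(Spr.holes S) : ℤ) ^ 2 + #(Spr.holes S)) - 2 * (8 * b + 4) * #(Spr.holes S)
      + 64 * b * (b + 1)) * 2 ^ n := by linear_combination 4 * h + m2 - 2 * (8 * b + 4) * m1
  exact nonneg_of_mul_nonneg_left this hN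

theorem Spr.upper {n : ℕ} (hn : 3 ≤ n) (h c : ℕ) (b : ℤ)
    (hb : ((h : ℤ) ^ 2 + h) - 2 * (8 * b + 4) * h + 64 * b * (b + 1) < 0)
    (hc : h + 7 * (c + 1) + 1 = 2 ^ n)
    (S : Finset (Submodule (ZMod 2) (Fin n → ZMod 2)))
    (hS : IsPartialSpread 3 S) : #S ≤ c := by
  by_contra hlt
  obtain ⟨T, hT, hTc⟩ := Finset.exists_subset_card_eq (s := S) (n := c + 1) (by omega)
  have hTS : IsPartialSpread 3 T :=
    ⟨fun U hU => hS.1 U (hT hU), fun U hU V hV => hS.2 U (hT hU) V (hT hV)⟩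
  have h1 := Spr.card_holes T hTS
  have h2 := Spr.ineq hn T hTS b
  have h3 : #(Spr.holes T) = h := by rw [hTc] at h1; omega
  rw [h3] at h2
  linarith

/-- A family of embeddings of `𝔽_2^3` with disjoint images. -/
def Spr.Fam (V ι : Type) [AddCommGroup V] [Module (ZMod 2) V] : Prop :=
  ∃ L : ι → (Fin 3 → ZMod 2) →ₗ[ZMod 2] V, (∀ i x, L i x = 0 → x = 0) ∧
    ∀ i j, i ≠ j → ∀ x y, L i x = L j y → x = 0

theorem Spr.Fam.toSpread {n : ℕ} {ι : Type} [Fintype ι] (h : Spr.Fam (Fin n → ZMod 2) ι) :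
    ∃ S : Finset (Submodule (ZMod 2) (Fin n → ZMod 2)),
        IsPartialSpread 3 S ∧ S.card = Fintype.card ι := by
  classical
  obtain ⟨L, h1, h2⟩ := h
  have inj : ∀ i, Function.Injective (L i) := fun i => (injective_iff_map_eq_zero _).2 (h1 i)
  have hr : Function.Injective (fun i => LinearMap.range (L i)) := by
    intro i j hij
    by_contra hne
    have h3 : L i 1 ∈ LinearMap.range (L j) := by
      have : L i 1 ∈ LinearMap.range (L i) := ⟨1, rfl⟩
      simpa only [← hij] using this
    obtain ⟨y, hy⟩ := h3
    have := h2 i j hne 1 y hy.symm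
    exact absurd this (by decide)
  refine ⟨Finset.univ.image (fun i => LinearMap.range (L i)), ⟨?_, ?_⟩, ?_⟩
  · intro U hU
    simp only [Finset.mem_image, Finset.mem_univ, true_and] at hU
    obtain ⟨i, rfl⟩ := hU
    rw [LinearMap.finrank_range_of_inj (inj i)]
    simp
  · intro U hU V hV hne
    simp only [Finset.mem_image, Finset.mem_univ, true_and] at hU hV
    obtain ⟨i, rfl⟩ := hU
    obtain ⟨j, rfl⟩ := hV
    rw [eq_bot_iff]
    rintro v ⟨⟨x, rfl⟩, ⟨y, hy⟩⟩
    have := h2 i j (by rintro rfl; exact hne rfl) x y hy.symm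
    simp [this]
  · rw [Finset.card_image_of_injective _ hr]; simp

theorem Spr.Fam.map {V W ι : Type} [AddCommGroup V] [Module (ZMod 2) V]
    [AddCommGroup W] [Module (ZMod 2) W] (e : V ≃ₗ[ZMod 2] W) (h : Spr.Fam V ι) :
    Spr.Fam W ι := by
  obtain ⟨L, h1, h2⟩ := h
  refine ⟨fun i => e.toLinearMap ∘ₗ L i, ?_, ?_⟩
  · intro i x hx
    exact h1 i x (by simpa using hx)
  · intro i j hij x y hxy
    exact h2 i j hij x y (by simpa using hxy)

theorem Spr.exists_inj {V : Type} [AddCommGroup V] [Module (ZMod 2) V]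
    (h : 3 ≤ Module.finrank (ZMod 2) V) :
    ∃ e : (Fin 3 → ZMod 2) →ₗ[ZMod 2] V, Function.Injective e := by
  obtain ⟨b, hb⟩ := exists_linearIndependent_of_le_finrank h
  refine ⟨Fintype.linearCombination (ZMod 2) b, ?_⟩
  exact hb.fintypeLinearCombination_injective

theorem Spr.Fam.step {n : ℕ} (hn : 3 ≤ n) {ι : Type} [Fintype ι]
    (h : Spr.Fam (Fin n → ZMod 2) ι) :
    Spr.Fam (Fin (n + 3) → ZMod 2) (GaloisField 2 n ⊕ ι) := by
  have hfr : Module.finrank (ZMod 2) (GaloisField 2 n) = n := GaloisField.finrank 2 (by omega)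
  let K := GaloisField 2 n
  obtain ⟨e, he⟩ : ∃ e : (Fin 3 → ZMod 2) →ₗ[ZMod 2] K, Function.Injective e :=
    Spr.exists_inj (by simp [K, hfr, hn])
  have hk : Spr.Fam K ι := h.map (LinearEquiv.ofFinrankEq _ _ (by simp [K, hfr]))
  have key : Spr.Fam (K × (Fin 3 → ZMod 2)) (K ⊕ ι) := by
    obtain ⟨L, h1, h2⟩ := hk
    refine ⟨Sum.elim (fun a => (LinearMap.mulLeft (ZMod 2) a ∘ₗ e).prod LinearMap.id)
      (fun i => (L i).prod 0), ?_, ?_⟩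
    · rintro (a | i) x hx
      · simp at hx; exact hx.2
      · simp at hx; exact h1 i x hx
    · rintro (a | i) (b | j) hij x y hxy
      · simp at hxy
        obtain ⟨h3, h4⟩ := hxy
        rw [← h4] at h3
        have hab : a ≠ b := by rintro rfl; exact hij rfl
        have h5 : (a - b) * e x = 0 := by rw [sub_mul, h3, sub_self]
        have h6 : e x = 0 := (mul_eq_zero.1 h5).resolve_left (sub_ne_zero.2 hab)
        exact he (by simpa using h6)
      · simp at hxy; exact hxy.2
      · simp at hxy
        obtain ⟨h3, h4⟩ := hxy
        subst h4
        exact h1 i x (by simpa using h3)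
      · simp at hxy
        exact h2 i j (by rintro rfl; exact hij rfl) x y hxy
  exact key.map (LinearEquiv.ofFinrankEq _ _ (by simp [K, hfr]))

theorem Spr.iter (r c : ℕ) (m₀ : ℕ) (hr : 3 ≤ 3 * m₀ + r) (hc : ∃ t, 2 ^ (3 * m₀ + r) = c + 7 * t)
    (h0 : ∃ (ι : Type) (_ : Fintype ι), Fintype.card ι = (2 ^ (3 * m₀ + r) - c) / 7 ∧
      Spr.Fam (Fin (3 * m₀ + r) → ZMod 2) ι) (m : ℕ) (hm : m₀ ≤ m) :
    (∃ t, 2 ^ (3 * m + r) = c + 7 * t) ∧ 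
    ∃ (ι : Type) (_ : Fintype ι), Fintype.card ι = (2 ^ (3 * m + r) - c) / 7 ∧
      Spr.Fam (Fin (3 * m + r) → ZMod 2) ι := by
  induction m, hm using Nat.le_induction with
  | base => exact ⟨hc, h0⟩
  | succ m hm ih =>
    obtain ⟨⟨t, ht⟩, ι, _, hι, hF⟩ := ih
    have e1 : 3 * (m + 1) + r = (3 * m + r) + 3 := by ring
    have e2 : 2 ^ (3 * (m + 1) + r) = c + 7 * (t + 2 ^ (3 * m + r)) := by
      rw [e1, pow_add]; omega
    refine ⟨⟨_, e2⟩, GaloisField 2 (3 * m + r) ⊕ ι, 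
      @instFintypeSum _ _ (Fintype.ofFinite _) _, ?_, ?_⟩
    · let _ : Fintype (GaloisField 2 (3 * m + r)) := Fintype.ofFinite _
      rw [Fintype.card_sum, hι, e2, ht, ← Nat.card_eq_fintype_card, GaloisField.card 2 _ (by omega),
        ht]
      omega
    · rw [e1]
      exact hF.step (by omega)

theorem Spr.single {n : ℕ} (hn : 3 ≤ n) : Spr.Fam (Fin n → ZMod 2) Unit := by
  obtain ⟨e, he⟩ : ∃ e : (Fin 3 → ZMod 2) →ₗ[ZMod 2] (Fin n → ZMod 2), Function.Injective e :=
    Spr.exists_inj (by simp [hn])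
  refine ⟨fun _ => e, fun _ x hx => he (by simpa using hx), fun i j hij => absurd rfl hij⟩

/-- Bases of the 34 planes in `𝔽_2^8`, as bit masks (found by computer search). -/
def Spr.table : List (ℕ × ℕ × ℕ) :=
  [(2,56,85), (16,37,76), (18,43,207), (42,95,132), (25,41,137), (61,91,156), (52,68,150),
   (15,17,226), (20,107,165), (28,47,135), (21,97,167), (36,71,147), (26,40,64), (55,82,130),
   (22,72,169), (32,66,154), (9,113,148), (29,110,173), (38,81,152), (33,69,153), (12,84,166),
   (27,45,77), (39,93,145), (62,89,146), (7,24,163), (23,44,194), (19,34,202), (10,118,149),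
   (63,83,140), (35,73,158), (60,65,151), (46,80,129), (1,4,74), (3,13,128)]

def Spr.comb (i : Fin 34) (a b c : Bool) : ℕ :=
  let t := Spr.table.getD i (0, 0, 0)
  ((bif a then t.1 else 0) ^^^ (bif b then t.2.1 else 0)) ^^^ (bif c then t.2.2 else 0)

def Spr.mask (i : Fin 34) : ℕ :=
  2 ^ Spr.comb i false false false + 2 ^ Spr.comb i false false true +
  2 ^ Spr.comb i false true false + 2 ^ Spr.comb i false true true +
  2 ^ Spr.comb i true false false + 2 ^ Spr.comb i true false true +
  2 ^ Spr.comb i true true false + 2 ^ Spr.comb i true true true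

theorem Spr.check1 : ∀ i a b c, (Spr.mask i).testBit (Spr.comb i a b c) = true := by
  decide +kernel
theorem Spr.check2 : ∀ i j, i ≠ j → Spr.mask i &&& Spr.mask j = 1 := by decide +kernel
theorem Spr.check3 : ∀ i a b c, Spr.comb i a b c = 0 → a = false ∧ b = false ∧ c = false := by
  decide +kernel
theorem Spr.check4 : ∀ i a b c, Spr.comb i a b c < 2 ^ 8 := by decide +kernel

def Spr.bits (v : ℕ) : Fin 8 → ZMod 2 := fun k => bif v.testBit k then 1 else 0

theorem Spr.bits_xor (v w : ℕ) : Spr.bits (v ^^^ w) = Spr.bits v + Spr.bits w := by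
  funext k
  simp only [Spr.bits, Nat.testBit_xor, Pi.add_apply]
  cases v.testBit k <;> cases w.testBit k <;> decide

theorem Spr.bits_inj (v w : ℕ) (hv : v < 2 ^ 8) (hw : w < 2 ^ 8) (h : Spr.bits v = Spr.bits w) :
    v = w := by
  apply Nat.eq_of_testBit_eq
  intro k
  by_cases hk : k < 8
  · have := congrFun h ⟨k, hk⟩
    simp only [Spr.bits] at this
    revert this
    cases v.testBit k <;> cases w.testBit k <;> decide
  · rw [Nat.testBit_lt_two_pow (lt_of_lt_of_le hv (Nat.pow_le_pow_right (by norm_num) (by omega))),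
      Nat.testBit_lt_two_pow (lt_of_lt_of_le hw (Nat.pow_le_pow_right (by norm_num) (by omega)))]

def Spr.tb (a : ZMod 2) : Bool := decide (a ≠ 0)

theorem Spr.smul_bits (a : ZMod 2) (v : ℕ) :
    a • Spr.bits v = Spr.bits (bif Spr.tb a then v else 0) := by
  have : ∀ a : ZMod 2, a = 0 ∨ a = 1 := by decide
  rcases this a with rfl | rfl
  · have : Spr.tb 0 = false := by decide
    rw [this]; funext k; simp [Spr.bits]
  · have : Spr.tb 1 = true := by decide
    rw [this]; simp

theorem Spr.tb_false : ∀ a, Spr.tb a = false → a = 0 := by decide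

theorem Spr.base34 : Spr.Fam (Fin 8 → ZMod 2) (Fin 34) := by
  let L : Fin 34 → (Fin 3 → ZMod 2) →ₗ[ZMod 2] (Fin 8 → ZMod 2) := fun i =>
    Fintype.linearCombination (ZMod 2) ![Spr.bits (Spr.table.getD i (0, 0, 0)).1,
      Spr.bits (Spr.table.getD i (0, 0, 0)).2.1, Spr.bits (Spr.table.getD i (0, 0, 0)).2.2]
  have hL : ∀ i x, L i x = Spr.bits (Spr.comb i (Spr.tb (x 0)) (Spr.tb (x 1)) (Spr.tb (x 2))) := by
    intro i x
    simp only [L, Fintype.linearCombination_apply, Fin.sum_univ_three, Spr.comb, Spr.bits_xor,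
      ← Spr.smul_bits]
    rfl
  have hz : ∀ i (x : Fin 3 → ZMod 2), Spr.comb i (Spr.tb (x 0)) (Spr.tb (x 1)) (Spr.tb (x 2)) = 0 → x = 0 := by
    intro i x h
    obtain ⟨h0, h1, h2⟩ := Spr.check3 _ _ _ _ h
    funext k
    fin_cases k
    · exact Spr.tb_false _ h0
    · exact Spr.tb_false _ h1
    · exact Spr.tb_false _ h2
  have b0 : Spr.bits 0 = 0 := by funext k; simp [Spr.bits]
  refine ⟨L, ?_, ?_⟩
  · intro i x h
    rw [hL, ← b0] at h
    exact hz i x (Spr.bits_inj _ _ (Spr.check4 _ _ _ _) (by norm_num) h)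
  · intro i j hij x y h
    rw [hL, hL] at h
    have h := Spr.bits_inj _ _ (Spr.check4 _ _ _ _) (Spr.check4 _ _ _ _) h
    apply hz i x
    have t1 := Spr.check1 i (Spr.tb (x 0)) (Spr.tb (x 1)) (Spr.tb (x 2))
    have t2 := Spr.check1 j (Spr.tb (y 0)) (Spr.tb (y 1)) (Spr.tb (y 2))
    rw [← h] at t2
    have t3 := congrArg (fun v => v.testBit (Spr.comb i (Spr.tb (x 0)) (Spr.tb (x 1)) (Spr.tb (x 2))))
      (Spr.check2 i j hij)
    simp only [Nat.testBit_and, t1, t2] at t3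
    by_contra hne
    have : Nat.testBit 1 (Spr.comb i (Spr.tb (x 0)) (Spr.tb (x 1)) (Spr.tb (x 2))) = false :=
      Nat.testBit_lt_two_pow (Nat.one_lt_two_pow hne)
    rw [this] at t3
    simp at t3

/-- Maximum sizes of partial `3`-spreads in `𝔽_2^{3m}`, `𝔽_2^{3m+1}`, `𝔽_2^{3m+2}`. -/
theorem partial_three_spread_max (m : ℕ) (hm : 2 ≤ m) :
    IsGreatest {c : ℕ | ∃ S : Finset (Submodule (ZMod 2) (Fin (3 * m) → ZMod 2)),
        IsPartialSpread 3 S ∧ S.card = c} ((2 ^ (3 * m) - 1) / 7) ∧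
    IsGreatest {c : ℕ | ∃ S : Finset (Submodule (ZMod 2) (Fin (3 * m + 1) → ZMod 2)),
        IsPartialSpread 3 S ∧ S.card = c} ((2 ^ (3 * m + 1) - 9) / 7) ∧
    IsGreatest {c : ℕ | ∃ S : Finset (Submodule (ZMod 2) (Fin (3 * m + 2) → ZMod 2)),
        IsPartialSpread 3 S ∧ S.card = c} ((2 ^ (3 * m + 2) - 18) / 7) := by
  obtain ⟨⟨ta, hta⟩, ιa, _, hca, hFa⟩ := Spr.iter 0 1 1 (by norm_num) ⟨1, by norm_num⟩
    ⟨Unit, inferInstance, by simp, Spr.single (by norm_num)⟩ m (by omega)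
  obtain ⟨⟨tb, htb⟩, ιb, _, hcb, hFb⟩ := Spr.iter 1 9 1 (by norm_num) ⟨1, by norm_num⟩
    ⟨Unit, inferInstance, by simp, Spr.single (by norm_num)⟩ m (by omega)
  obtain ⟨⟨tc, htc⟩, ιc, _, hcc, hFc⟩ := Spr.iter 2 18 2 (by norm_num) ⟨34, by norm_num⟩
    ⟨Fin 34, inferInstance, by simp, Spr.base34⟩ m (by omega)
  refine ⟨⟨?_, ?_⟩, ⟨?_, ?_⟩, ⟨?_, ?_⟩⟩
  · have := hFa.toSpread
    rw [hca] at this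
    exact this
  · rintro c ⟨S, hS, rfl⟩
    have := Spr.card_holes S hS
    omega
  · have := hFb.toSpread
    rw [hcb] at this
    exact this
  · rintro c ⟨S, hS, rfl⟩
    refine Spr.upper (by omega) 1 _ 0 (by norm_num) ?_ S hS
    omega
  · have := hFc.toSpread
    rw [hcc] at this
    exact this
  · rintro c ⟨S, hS, rfl⟩
    refine Spr.upper (by omega) 10 _ 1 (by norm_num) ?_ S hS
    omega
end

section
/- Let t ≥ 1 and k ≥ 4 be integers and set m = (2^{k(t+1)+2} − 2^{k+1} − 2)/(2^k − 1). Then there is no vector space partition of 𝔽_2^{k(t+1)+2} consisting of exactly m subspaces of dimension k and exactly 2^{k+1} + 1 subspaces of dimension 1 (and no subspaces of any other dimension). In particular, every partial k-spread in 𝔽_2^{k(t+1)+2} has cardinality strictly less than m. -/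
open Classical in
theorem half_card {W : Type*} [AddCommGroup W] [Module (ZMod 2) W] [Fintype W]
    (φ : W →ₗ[ZMod 2] ZMod 2) (h : φ ≠ 0) :
    2 * (Finset.univ.filter (fun x => φ x ≠ 0)).card = Fintype.card W := by
  obtain ⟨u, hu⟩ : ∃ u, φ u ≠ 0 := by
    by_contra hc
    push Not at hc
    exact h (LinearMap.ext hc)
  have key : ∀ a b : ZMod 2, b ≠ 0 → (a ≠ 0 ↔ ¬ (a + b ≠ 0)) := by decide
  have e : (Finset.univ.filter (fun x => φ x ≠ 0)).card
      = (Finset.univ.filter (fun x => ¬ (φ x ≠ 0))).card := by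
    refine Finset.card_bij (fun x _ => x + u) ?_ ?_ ?_
    · intro x hx
      simp only [Finset.mem_filter, Finset.mem_univ, true_and, map_add] at hx ⊢
      exact (key _ _ hu).1 hx
    · intro x _ y _ hxy
      exact add_right_cancel hxy
    · intro y hy
      simp only [Finset.mem_filter, Finset.mem_univ, true_and] at hy
      refine ⟨y - u, ?_, by simp⟩
      simp only [Finset.mem_filter, Finset.mem_univ, true_and]
      refine (key _ _ hu).2 ?_
      rw [← map_add]
      simpa using hy
  have := Finset.card_filter_add_card_filter_not (s := (Finset.univ : Finset W)) (fun x => φ x ≠ 0)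
  rw [Finset.card_univ] at this
  omega

/-- weight of a functional on a finite set of vectors -/
noncomputable def wt {V : Type*} [AddCommGroup V] [Module (ZMod 2) V]
    (S : Finset V) (f : V →ₗ[ZMod 2] ZMod 2) : ℕ := by
  classical exact (S.filter (fun x => f x ≠ 0)).card

open Classical in
theorem wt_def {V : Type*} [AddCommGroup V] [Module (ZMod 2) V]
    (S : Finset V) (f : V →ₗ[ZMod 2] ZMod 2) : wt S f = (S.filter (fun x => f x ≠ 0)).card := by
  unfold wt
  congr

open Classical in
theorem exists_heavy {V : Type*} [AddCommGroup V] [Module (ZMod 2) V] [Finite V]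
    (S : Finset V) (h0 : (0 : V) ∉ S) : ∃ f : V →ₗ[ZMod 2] ZMod 2, S.card ≤ 2 * wt S f := by
  by_contra hc
  push Not at hc
  have : Finite (V →ₗ[ZMod 2] ZMod 2) := Finite.of_injective _ DFunLike.coe_injective
  have := Fintype.ofFinite (V →ₗ[ZMod 2] ZMod 2)
  have h1 : ∑ f : V →ₗ[ZMod 2] ZMod 2, 2 * wt S f < ∑ f : V →ₗ[ZMod 2] ZMod 2, S.card :=
    Finset.sum_lt_sum_of_nonempty ⟨0, Finset.mem_univ _⟩ (fun f _ => hc f)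
  have h2 : ∑ f : V →ₗ[ZMod 2] ZMod 2, 2 * wt S f
      = ∑ x ∈ S, 2 * (Finset.univ.filter (fun f : V →ₗ[ZMod 2] ZMod 2 => f x ≠ 0)).card := by
    rw [← Finset.mul_sum, ← Finset.mul_sum]
    simp only [wt_def, Finset.card_filter]
    rw [Finset.sum_comm]
  have h3 : ∀ x ∈ S, 2 * (Finset.univ.filter (fun f : V →ₗ[ZMod 2] ZMod 2 => f x ≠ 0)).card
      = Fintype.card (V →ₗ[ZMod 2] ZMod 2) := by
    intro x hx
    have hx0 : x ≠ 0 := fun h => h0 (h ▸ hx)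
    have := half_card (LinearMap.applyₗ (R := ZMod 2) (M₂ := ZMod 2) x) (by
      obtain ⟨f, hf⟩ : ∃ f : V →ₗ[ZMod 2] ZMod 2, f x ≠ 0 := by
        by_contra hh
        push Not at hh
        exact hx0 ((Module.forall_dual_apply_eq_zero_iff (ZMod 2) x).1 hh)
      intro h
      exact hf (by simpa using LinearMap.congr_fun h f))
    simpa using this
  rw [h2, Finset.sum_congr rfl h3] at h1
  simp only [Finset.sum_const, smul_eq_mul, Finset.card_univ] at h1
  rw [mul_comm] at h1
  exact lt_irrefl _ h1

open Classical in
theorem restrict_dvd {V : Type*} [AddCommGroup V] [Module (ZMod 2) V]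
    (S : Finset V) (D : ℕ) (h : ∀ f : V →ₗ[ZMod 2] ZMod 2, 2 * D ∣ wt S f)
    (f : V →ₗ[ZMod 2] ZMod 2) :
    ∀ g : V →ₗ[ZMod 2] ZMod 2, D ∣ wt (S.filter (fun x => f x = 0)) g := by
  intro g
  have key : ∀ a b : ZMod 2, (if a ≠ 0 then 1 else 0) + 2 * (if a = 0 then (if b ≠ 0 then 1 else 0) else 0)
      = (if b ≠ 0 then 1 else 0) + (if a + b ≠ 0 then 1 else 0) := by decide
  have e : wt S f + 2 * wt (S.filter (fun x => f x = 0)) g = wt S g + wt S (f + g) := by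
    simp only [wt_def, Finset.card_filter, Finset.sum_filter, Finset.mul_sum,
      ← Finset.sum_add_distrib]
    exact Finset.sum_congr rfl (fun x _ => key (f x) (g x))
  have h1 : 2 * D ∣ 2 * wt (S.filter (fun x => f x = 0)) g :=
    (Nat.dvd_add_right (h f)).1 (e ▸ dvd_add (h g) (h (f + g)))
  exact Nat.dvd_of_mul_dvd_mul_left (by norm_num) h1

open Classical in
theorem wt_add {V : Type*} [AddCommGroup V] [Module (ZMod 2) V]
    (S : Finset V) (f : V →ₗ[ZMod 2] ZMod 2) :
    wt S f + (S.filter (fun x => f x = 0)).card = S.card := by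
  rw [wt_def]
  have := Finset.card_filter_add_card_filter_not (s := S) (fun x => f x = 0)
  simp only [← ne_eq] at this
  omega

theorem no_one {V : Type*} [AddCommGroup V] [Module (ZMod 2) V] [Finite V]
    (S : Finset V) (h0 : (0 : V) ∉ S) (h : ∀ f : V →ₗ[ZMod 2] ZMod 2, 2 ∣ wt S f) :
    S.card ≠ 1 := by
  intro hc
  obtain ⟨f, hf⟩ := exists_heavy S h0
  have := wt_add S f
  have := h f
  omega

theorem no_two {V : Type*} [AddCommGroup V] [Module (ZMod 2) V] [Finite V] (D : ℕ)
    (S : Finset V) (h0 : (0 : V) ∉ S) (h : ∀ f : V →ₗ[ZMod 2] ZMod 2, 4 * D ∣ wt S f) :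
    S.card ≠ 8 * D + 1 := by
  classical
  intro hc
  obtain ⟨f, hf⟩ := exists_heavy S h0
  have h1 := wt_add S f
  obtain ⟨c, hw⟩ := h f
  have h2 := no_one (S.filter (fun x => f x = 0)) (by simp [h0])
    (fun g => dvd_trans (dvd_mul_right 2 D)
      (restrict_dvd S (2 * D) (fun f => by simpa [← mul_assoc] using h f) f g))
  have hD : 0 < D := by
    rcases Nat.eq_zero_or_pos D with h | h
    · subst h; omega
    · exact h
  have hc2 : c < 3 := by
    by_contra hh
    have : 4 * D * 3 ≤ 4 * D * c := Nat.mul_le_mul_left _ (by omega)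
    omega
  interval_cases c <;> omega

theorem no_four {V : Type*} [AddCommGroup V] [Module (ZMod 2) V] [Finite V] (D : ℕ)
    (S : Finset V) (h0 : (0 : V) ∉ S) (h : ∀ f : V →ₗ[ZMod 2] ZMod 2, 8 * D ∣ wt S f) :
    S.card ≠ 32 * D + 1 := by
  classical
  intro hc
  obtain ⟨f, hf⟩ := exists_heavy S h0
  have h1 := wt_add S f
  obtain ⟨c, hw⟩ := h f
  have hr := restrict_dvd S (4 * D) (fun f => by simpa [← mul_assoc] using h f) f
  have h2 := no_one (S.filter (fun x => f x = 0)) (by simp [h0])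
    (fun g => dvd_trans ⟨2 * D, by ring⟩ (hr g))
  have h3 := no_two D (S.filter (fun x => f x = 0)) (by simp [h0]) hr
  have hD : 0 < D := by
    rcases Nat.eq_zero_or_pos D with h | h
    · subst h; omega
    · exact h
  have hc2 : c < 5 := by
    by_contra hh
    have : 8 * D * 5 ≤ 8 * D * c := Nat.mul_le_mul_left _ (by omega)
    omega
  interval_cases c <;> omega

open Classical in
theorem sub_wt {V : Type*} [AddCommGroup V] [Module (ZMod 2) V] [Fintype V]
    (U : Submodule (ZMod 2) V) (k : ℕ) (hU : Module.finrank (ZMod 2) U = k + 1)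
    (f : V →ₗ[ZMod 2] ZMod 2) :
    2 ^ k ∣ (Finset.univ.filter (fun x => x ∈ U ∧ f x ≠ 0)).card := by
  have hcard : Fintype.card U = 2 ^ (k + 1) := by
    rw [Module.card_eq_pow_finrank (K := ZMod 2), hU, ZMod.card]
  have e : (Finset.univ.filter (fun x => x ∈ U ∧ f x ≠ 0)).card
      = (Finset.univ.filter (fun x : U => f.domRestrict U x ≠ 0)).card := by
    symm
    refine Finset.card_bij (fun x _ => (x : V)) ?_ ?_ ?_
    · intro x hx
      have h1 := (Finset.mem_filter.1 hx).2
      exact Finset.mem_filter.2 ⟨Finset.mem_univ _, x.2, h1⟩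
    · intro x _ y _ h; exact Subtype.ext h
    · intro y hy
      simp only [Finset.mem_filter, Finset.mem_univ, true_and] at hy
      exact ⟨⟨y, hy.1⟩, Finset.mem_filter.2 ⟨Finset.mem_univ _, hy.2⟩, rfl⟩
  rw [e]
  by_cases h : f.domRestrict U = 0
  · rw [h]; simp
  · have := half_card _ h
    rw [hcard, pow_succ] at this
    exact ⟨1, by omega⟩

theorem main_aux (n k : ℕ) (hk : 3 ≤ k) (hn : k + 1 ≤ n)
    (T : Finset (Submodule (ZMod 2) (Fin n → ZMod 2))) (hT : IsPartialSpread (k + 1) T)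
    (hcard : T.card * (2 ^ (k + 1) - 1) + 2 ^ (k + 2) + 2 = 2 ^ n) : False := by
  classical
  let B : Submodule (ZMod 2) (Fin n → ZMod 2) → Finset (Fin n → ZMod 2) :=
    fun U => Finset.univ.filter (fun x => x ∈ U ∧ x ≠ 0)
  have hdisj : (T : Set (Submodule (ZMod 2) (Fin n → ZMod 2))).PairwiseDisjoint B := by
    intro U hU W hW hne
    rw [Function.onFun, Finset.disjoint_left]
    intro x hx hy
    simp only [B, Finset.mem_filter, Finset.mem_univ, true_and] at hx hy
    have : x ∈ U ⊓ W := ⟨hx.1, hy.1⟩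
    rw [hT.2 U hU W hW hne] at this
    exact hx.2 (by simpa using this)
  let A : Finset (Fin n → ZMod 2) := Finset.univ.filter (fun x => x ≠ 0)
  have hsub : T.biUnion B ⊆ A := by
    intro x hx
    simp only [Finset.mem_biUnion, B, A, Finset.mem_filter, Finset.mem_univ, true_and] at hx ⊢
    obtain ⟨U, _, _, h⟩ := hx
    exact h
  have hBcard : ∀ U ∈ T, (B U).card = 2 ^ (k + 1) - 1 := by
    intro U hU
    have h1 : Fintype.card U = 2 ^ (k + 1) := by
      rw [Module.card_eq_pow_finrank (K := ZMod 2), hT.1 U hU, ZMod.card]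
    have h2 : B U = (Finset.univ.filter (fun x => x ∈ U)).erase 0 := by
      ext x; simp [B, and_comm]
    rw [h2, Finset.card_erase_of_mem (by simp), ← h1, Fintype.card_subtype]
  have hAcard : A.card = 2 ^ n - 1 := by
    have h2 : A = Finset.univ.erase 0 := by ext x; simp [A]
    rw [h2, Finset.card_erase_of_mem (by simp), Finset.card_univ]
    simp
  have hUcard : (T.biUnion B).card = T.card * (2 ^ (k + 1) - 1) := by
    rw [Finset.card_biUnion hdisj, Finset.sum_congr rfl hBcard]; simp
  let H := A \ T.biUnion B
  have hHcard : H.card + (T.biUnion B).card = A.card := Finset.card_sdiff_add_card_eq_card hsub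
  have hwt : ∀ f : (Fin n → ZMod 2) →ₗ[ZMod 2] ZMod 2, 2 ^ k ∣ wt H f := by
    intro f
    have e1 : wt H f + wt (T.biUnion B) f = wt A f := by
      simp only [wt_def, Finset.card_filter]
      exact Finset.sum_sdiff hsub
    have e2 : wt (T.biUnion B) f = ∑ U ∈ T, wt (B U) f := by
      simp only [wt_def, Finset.card_filter]
      exact Finset.sum_biUnion hdisj
    have d2 : 2 ^ k ∣ wt (T.biUnion B) f := by
      rw [e2]
      refine Finset.dvd_sum (fun U hU => ?_)
      refine dvd_trans (sub_wt U k (hT.1 U hU) f) (dvd_of_eq ?_)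
      symm
      rw [wt_def, Finset.filter_filter]
      congr 1
      ext x
      simp only [Finset.mem_filter, Finset.mem_univ, true_and]
      constructor
      · rintro ⟨⟨h1, _⟩, h3⟩; exact ⟨h1, h3⟩
      · rintro ⟨h1, h3⟩; exact ⟨⟨h1, fun h => h3 (by rw [h, map_zero])⟩, h3⟩
    have dA : 2 ^ k ∣ wt A f := by
      refine dvd_trans (pow_dvd_pow 2 (show k ≤ n - 1 by omega)) ?_
      refine dvd_trans (sub_wt (⊤ : Submodule (ZMod 2) (Fin n → ZMod 2)) (n - 1)
        (by rw [finrank_top, Module.finrank_fin_fun]; omega) f) (dvd_of_eq ?_)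
      symm
      rw [wt_def, Finset.filter_filter]
      congr 1
      ext x
      simp only [Finset.mem_filter, Finset.mem_univ, true_and, Submodule.mem_top]
      constructor
      · rintro ⟨_, h3⟩; exact h3
      · intro h3; exact ⟨fun h => h3 (by rw [h, map_zero]), h3⟩
    rw [← e1] at dA
    exact (Nat.dvd_add_left d2).1 dA
  obtain ⟨j, rfl⟩ : ∃ j, k = j + 3 := ⟨k - 3, by omega⟩
  have p1 : 2 ^ (j + 3) = 8 * 2 ^ j := by ring
  have p2 : 2 ^ (j + 3 + 2) = 32 * 2 ^ j := by ring
  refine no_four (2 ^ j) H (by simp [H, A]) (fun f => p1 ▸ hwt f) ?_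
  rw [hUcard, hAcard] at hHcard
  omega

theorem arith (t k m : ℕ) (hk : 1 ≤ k) 
    (hm : m = (2 ^ (k * (t + 1) + 2) - 2 ^ (k + 1) - 2) / (2 ^ k - 1)) :
    m * (2 ^ k - 1) + 2 ^ (k + 1) + 2 = 2 ^ (k * (t + 1) + 2) := by
  obtain ⟨a, ha⟩ : ∃ a, 2 ^ k = a + 1 := ⟨2 ^ k - 1, by have := Nat.one_le_two_pow (n := k); omega⟩
  obtain ⟨c, hc⟩ : ∃ c, (2 ^ k) ^ t = a * c + 1 := by
    have : a ∣ (2 ^ k) ^ t - 1 := by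
      have := Nat.sub_dvd_pow_sub_pow (2 ^ k) 1 t
      rwa [one_pow, ha, Nat.add_sub_cancel, ← ha] at this
    obtain ⟨c, hc⟩ := this
    have : 1 ≤ (2 ^ k) ^ t := Nat.one_le_pow _ _ (by positivity)
    exact ⟨c, by omega⟩
  have ha1 : 1 ≤ a := by
    have := Nat.pow_le_pow_right (show 0 < 2 by norm_num) hk
    omega
  have e : 2 ^ (k * (t + 1) + 2) = (4 * (a + 1) * c + 2) * a + 2 ^ (k + 1) + 2 := by
    have : 2 ^ (k * (t + 1) + 2) = 4 * ((2 ^ k) ^ t * 2 ^ k) := by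
      rw [← pow_mul]; ring
    rw [this, hc, pow_succ, ha]; ring
  have hma : m = 4 * (a + 1) * c + 2 := by
    rw [hm, e, Nat.sub_sub, add_assoc, Nat.add_sub_cancel, ha, Nat.add_sub_cancel,
      Nat.mul_div_cancel _ ha1]
  rw [e, ← hma, ha, Nat.add_sub_cancel]

/-- For `t ≥ 1`, `k ≥ 4` and `m = (2^{k(t+1)+2} − 2^{k+1} − 2)/(2^k − 1)`, there
is no vector space partition of `𝔽_2^{k(t+1)+2}` of type `k^m 1^{2^{k+1}+1}`;
in particular every partial `k`-spread in `𝔽_2^{k(t+1)+2}` has fewer than `m`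
members. -/
theorem no_partition_type_km (t k m : ℕ) (ht : 1 ≤ t) (hk : 4 ≤ k)
    (hm : m = (2 ^ (k * (t + 1) + 2) - 2 ^ (k + 1) - 2) / (2 ^ k - 1)) :
    (¬ ∃ P : Finset (Submodule (ZMod 2) (Fin (k * (t + 1) + 2) → ZMod 2)),
        (⊥ ∉ P) ∧
        (∀ v : Fin (k * (t + 1) + 2) → ZMod 2, v ≠ 0 → ∃! U, U ∈ P ∧ v ∈ U) ∧
        (∀ U ∈ P, Module.finrank (ZMod 2) U = k ∨ Module.finrank (ZMod 2) U = 1) ∧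
        (P.filter (fun (U : Submodule (ZMod 2) (Fin (k * (t + 1) + 2) → ZMod 2)) =>
          Module.finrank (ZMod 2) ↥U = k)).card = m ∧
        (P.filter (fun (U : Submodule (ZMod 2) (Fin (k * (t + 1) + 2) → ZMod 2)) =>
          Module.finrank (ZMod 2) ↥U = 1)).card = 2 ^ (k + 1) + 1) ∧
    (∀ S : Finset (Submodule (ZMod 2) (Fin (k * (t + 1) + 2) → ZMod 2)),
        IsPartialSpread k S → S.card < m) := by
  have har := arith t k m (by omega) hm
  obtain ⟨j, rfl⟩ : ∃ j, k = j + 1 := ⟨k - 1, by omega⟩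
  have hn : j + 1 ≤ (j + 1) * (t + 1) + 2 := by nlinarith
  constructor
  · rintro ⟨P, -, hP, -, hcard, -⟩
    refine main_aux _ j (by omega) hn _ ⟨fun U hU => (Finset.mem_filter.1 hU).2, ?_⟩
      (hcard.symm ▸ har)
    intro U hU W hW hne
    rw [Submodule.eq_bot_iff]
    intro x hx
    by_contra hx0
    exact hne ((hP x hx0).unique ⟨(Finset.mem_filter.1 hU).1, hx.1⟩
      ⟨(Finset.mem_filter.1 hW).1, hx.2⟩)
  · intro S hS
    by_contra hlt
    obtain ⟨T, hTS, hT⟩ := Finset.exists_subset_card_eq (not_lt.1 hlt)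
    exact main_aux _ j (by omega) hn T ⟨fun U hU => hS.1 U (hTS hU),
      fun U hU W hW => hS.2 U (hTS hU) W (hTS hW)⟩ (hT.symm ▸ har)
end
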